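/- Let S be a finite conformal iterated function system with limit set Λ, ψ a Hölder continuous potential with equilibrium measure μ^+ on Σ_I^+, μ̂ the equilibrium measure of ψ∘π_1 for the skew product Φ, ν_2 := (π_2)_* μ̂, and {μ_ω} the conditional measures of μ̂ on the fibers {ω}×Λ. Then there exists a constant C > 0 such that for μ^+-a.e. ω ∈ Σ_I^+ and every Borel set A ⊂ Λ, (1/C)·μ_ω(A) ≤ ν_2(A) ≤ C·μ_ω(A). -/

import Mathlib

open MeasureTheory Set Filter Metric
open scoped NNReal ENNReal Topology

noncomputable section

/-- Euclidean space `ℝ^D`. -/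
abbrev EucSp (D : ℕ) := EuclideanSpace ℝ (Fin D)

/-- The one-sided symbolic space `Σ_m^+` on `m` symbols. -/
abbrev SymbSp (m : ℕ) := ℕ → Fin m

/-- The one-sided shift `σ`. -/
def shift {m : ℕ} : SymbSp m → SymbSp m := fun ω n => ω (n + 1)

/-- The word `ω_1 … ω_n` of the first `n` symbols of `ω`. -/
def word {m : ℕ} (ω : SymbSp m) (n : ℕ) : List (Fin m) := (List.range n).map ω

/-- The cylinder `[w_1 … w_n]` on a finite word `w`. -/
def cyl {m : ℕ} (w : List (Fin m)) : Set (SymbSp m) := {ω | word ω w.length = w}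

/-- The composition `φ_{i_1 … i_p} := φ_{i_1} ∘ … ∘ φ_{i_p}`. -/
def compWord {D m : ℕ} (φ : Fin m → EucSp D → EucSp D) : List (Fin m) → EucSp D → EucSp D
  | [] => id
  | i :: w => φ i ∘ compWord φ w

/-- Birkhoff sum `S_n ψ` with respect to the shift. -/
def birk {m : ℕ} (ψ : SymbSp m → ℝ) (n : ℕ) (ω : SymbSp m) : ℝ :=
  ∑ k ∈ Finset.range n, ψ (shift^[k] ω)

/-- Hölder continuity of a potential on the shift space (variation on cylinders
decays geometrically). -/
def HolderPotential {m : ℕ} (ψ : SymbSp m → ℝ) : Prop :=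
  ∃ C > (0 : ℝ), ∃ θ ∈ Ioo (0 : ℝ) 1, ∀ (n : ℕ) (ω η : SymbSp m),
    word ω n = word η n → |ψ ω - ψ η| ≤ C * θ ^ n

/-- The Gibbs property of a measure `μ` for the potential `ψ` with pressure `P`. -/
def IsGibbs {m : ℕ} (ψ : SymbSp m → ℝ) (P : ℝ) (μ : Measure (SymbSp m)) : Prop :=
  ∃ C : ℝ, 1 ≤ C ∧ ∀ (ω : SymbSp m) (n : ℕ),
    C⁻¹ * Real.exp (birk ψ n ω - n * P) ≤ (μ (cyl (word ω n))).toReal ∧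
    (μ (cyl (word ω n))).toReal ≤ C * Real.exp (birk ψ n ω - n * P)

/-- `μ` is the equilibrium (Gibbs) measure of the Hölder potential `ψ` for the
shift, with pressure `P`: it is a shift-invariant probability measure with the
Gibbs property; its entropy then satisfies `h(μ) = P - ∫ ψ dμ`. -/
def IsEquilibrium {m : ℕ} (ψ : SymbSp m → ℝ) (P : ℝ) (μ : Measure (SymbSp m)) : Prop :=
  IsProbabilityMeasure μ ∧ μ.map shift = μ ∧ IsGibbs ψ P μ

/-- A finite conformal iterated function system of injective contractions of a
compact set `V ⊂ ℝ^D` with nonempty interior. -/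
structure CIFS (D m : ℕ) where
  V : Set (EucSp D)
  φ : Fin m → EucSp D → EucSp D
  compactV : IsCompact V
  interiorV : (interior V).Nonempty
  mapsToV : ∀ i, MapsTo (φ i) V V
  injOnV : ∀ i, InjOn (φ i) V
  contraction : ∀ i, ∃ r : ℝ≥0, r < 1 ∧ LipschitzOnWith r (φ i) V
  conformal : ∀ i, ∀ x ∈ V, ConformalAt (φ i) x
  measurable_φ : ∀ i, Measurable (φ i)

/-- The limit set `Λ = ⋃_ω ⋂_n φ_{ω_1…ω_n}(V)`. -/
def CIFS.limitSet {D m : ℕ} (S : CIFS D m) : Set (EucSp D) :=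
  ⋃ ω : SymbSp m, ⋂ n : ℕ, compWord S.φ (word ω n) '' S.V

/-- `π` is the canonical coding map: `π(ω) ∈ φ_{ω_1…ω_n}(V)` for every `n`. -/
def CIFS.IsCoding {D m : ℕ} (S : CIFS D m) (π : SymbSp m → EucSp D) : Prop :=
  ∀ (ω : SymbSp m) (n : ℕ), π ω ∈ compWord S.φ (word ω n) '' S.V

/-- The skew product `Φ(ω,x) = (σω, φ_{ω_1}(x))`. -/
def skew {D m : ℕ} (S : CIFS D m) : SymbSp m × EucSp D → SymbSp m × EucSp D :=
  fun p => (shift p.1, S.φ (p.1 0) p.2)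

/-- `μ̂` is the equilibrium measure of `ψ ∘ π_1` for the skew product `Φ`, lifting
the equilibrium measure `μ⁺` of `ψ`: it is the unique `Φ`-invariant probability
measure on `Σ_m^+ × Λ` with `(π_1)_* μ̂ = μ⁺` (uniqueness holds since `Φ`
contracts the fibers). -/
def CIFS.IsLift {D m : ℕ} (S : CIFS D m) (μplus : Measure (SymbSp m))
    (μhat : Measure (SymbSp m × EucSp D)) : Prop :=
  IsProbabilityMeasure μhat ∧ μhat.map (skew S) = μhat ∧
    μhat.map Prod.fst = μplus ∧ μhat {p | p.2 ∈ S.limitSet}ᶜ = 0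

/-- Parry's Jacobian `J_T(μ)` of a measure `μ` under `T`: `μ(T(A)) = ∫_A J dμ` for
every measurable set `A` on which `T` is injective. The folding entropy is
`F_T(μ) = ∫ log J_T(μ) dμ` and the overlap number is `o = exp (F_T(μ))`. -/
def IsJacobianOf {α : Type*} [MeasurableSpace α] (T : α → α) (μ : Measure α)
    (J : α → ℝ) : Prop :=
  Measurable J ∧ ∀ A : Set α, MeasurableSet A → InjOn T A →
    μ (T '' A) = ENNReal.ofReal (∫ x in A, J x ∂μ)

/-- The stable Lyapunov exponent `χ_s(μ̂) = ∫ log |φ'_{ω_1}(x)| dμ̂(ω,x)`, where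
`|φ'_i(x)|` is the conformal derivative norm `‖(Dφ_i)_x‖`. -/
def CIFS.chiS {D m : ℕ} (S : CIFS D m) (μhat : Measure (SymbSp m × EucSp D)) : ℝ :=
  ∫ p : SymbSp m × EucSp D, Real.log ‖fderiv ℝ (S.φ (p.1 0)) p.2‖ ∂μhat

/-- The Hausdorff dimension `HD(ν)` of a measure: the infimum of the Hausdorff
dimensions of sets of full `ν`-measure. -/
def measDimH {X : Type*} [EMetricSpace X] [MeasurableSpace X] (ν : Measure X) : ℝ≥0∞ :=
  ⨅ (A : Set X) (_ : ν Aᶜ = 0), dimH A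

/-- `ν` is exact dimensional with pointwise dimension `d`: for `ν`-a.e. `x`,
`lim_{r→0} log ν(B(x,r)) / log r = d`. -/
def exactDimensionalWith {X : Type*} [PseudoMetricSpace X] [MeasurableSpace X]
    (ν : Measure X) (d : ℝ) : Prop :=
  ∀ᵐ x ∂ν, Tendsto (fun r : ℝ => Real.log (ν (Metric.ball x r)).toReal / Real.log r)
    (𝓝[>] (0 : ℝ)) (𝓝 d)

/-- `κ` is the system of Rokhlin conditional measures `{μ_ω}` of `μ̂` with respect
to the partition into fibers `{ω} × Λ` of `π_1`, viewed as measures on `Λ ⊆ ℝ^D`: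
for `μ⁺`-a.e. `ω` and every Borel `A`,
`μ_ω(A) = lim_n μ̂([ω_1…ω_n] × A) / μ⁺([ω_1…ω_n])`. -/
def IsCondSystem {D m : ℕ} (μplus : Measure (SymbSp m))
    (μhat : Measure (SymbSp m × EucSp D)) (κ : SymbSp m → Measure (EucSp D)) : Prop :=
  ∀ᵐ ω ∂μplus, ∀ A : Set (EucSp D), MeasurableSet A →
    Tendsto (fun n : ℕ => μhat (cyl (word ω n) ×ˢ A) / μplus (cyl (word ω n)))
      atTop (𝓝 (κ ω A))

lemma mem_cyl_word_iff {m : ℕ} (ω η : SymbSp m) (n : ℕ) :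
    ω ∈ cyl (word η n) ↔ ∀ j < n, ω j = η j := by
  simp [cyl, word]

lemma shift_iterate_apply {m : ℕ} (n : ℕ) (ω : SymbSp m) (j : ℕ) :
    shift^[n] ω j = ω (n + j) := by
  induction n generalizing ω with
  | zero => simp
  | succ n ih =>
    rw [Function.iterate_succ_apply, ih]
    simp only [shift]
    congr 1
    omega

lemma birk_add {m : ℕ} (ψ : SymbSp m → ℝ) (n k : ℕ) (ω : SymbSp m) :
    birk ψ (n + k) ω = birk ψ n ω + birk ψ k (shift^[n] ω) := by
  simp only [birk, Finset.sum_range_add, ← Function.iterate_add_apply]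
  simp only [add_comm]

lemma measurable_shift {m : ℕ} : Measurable (shift (m := m)) :=
  measurable_pi_lambda _ fun n => measurable_pi_apply (n + 1)

lemma measurableSet_cyl_word {m : ℕ} (ζ : SymbSp m) (n : ℕ) :
    MeasurableSet (cyl (word ζ n)) := by
  have h : cyl (word ζ n) = ⋂ j, ⋂ (_ : j < n), (fun ω : SymbSp m => ω j) ⁻¹' {ζ j} := by
    ext ω
    simp [mem_cyl_word_iff]
  rw [h]
  exact MeasurableSet.iInter fun j => MeasurableSet.iInter fun _ =>
    measurable_pi_apply j (measurableSet_singleton _)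

lemma measurable_skew {D m : ℕ} (S : CIFS D m) : Measurable (skew S) := by
  have h : Measurable fun q : Fin m × EucSp D => S.φ q.1 q.2 :=
    measurable_from_prod_countable_right S.measurable_φ
  exact (measurable_shift.comp measurable_fst).prodMk
    (h.comp (g := fun q : Fin m × EucSp D => S.φ q.1 q.2)
      (f := fun p : SymbSp m × EucSp D => (p.1 0, p.2))
      (((measurable_pi_apply 0).comp measurable_fst).prodMk measurable_snd))

lemma skew_iterate_fst {D m : ℕ} (S : CIFS D m) (n : ℕ) (p : SymbSp m × EucSp D) :
    ((skew S)^[n] p).1 = shift^[n] p.1 := by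
  induction n generalizing p with
  | zero => rfl
  | succ n ih => rw [Function.iterate_succ_apply, ih, Function.iterate_succ_apply]; rfl

lemma skew_iterate_succ_snd {D m : ℕ} (S : CIFS D m) (n : ℕ) (p : SymbSp m × EucSp D) :
    ((skew S)^[n + 1] p).2 = S.φ (p.1 n) ((skew S)^[n] p).2 := by
  rw [Function.iterate_succ_apply']
  simp only [skew, skew_iterate_fst, shift_iterate_apply, add_zero]

lemma skew_iterate_snd_congr {D m : ℕ} (S : CIFS D m) (n : ℕ) (x : EucSp D)
    {ω η : SymbSp m} (h : ∀ j < n, ω j = η j) :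
    ((skew S)^[n] (ω, x)).2 = ((skew S)^[n] (η, x)).2 := by
  induction n with
  | zero => rfl
  | succ n ih =>
    rw [skew_iterate_succ_snd, skew_iterate_succ_snd, ih fun j hj => h j (by omega)]
    simp only [h n (by omega)]

lemma skew_iterate_snd_mem {D m : ℕ} (S : CIFS D m) (n : ℕ) (ω : SymbSp m)
    {x : EucSp D} (hx : x ∈ S.V) : ((skew S)^[n] (ω, x)).2 ∈ S.V := by
  induction n with
  | zero => exact hx
  | succ n ih => rw [skew_iterate_succ_snd]; exact S.mapsToV _ ih

lemma CIFS.exists_uniform_contraction {D m : ℕ} (S : CIFS D m) :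
    ∃ r : ℝ≥0, r < 1 ∧ ∀ i, LipschitzOnWith r (S.φ i) S.V := by
  choose r hr hL using S.contraction
  refine ⟨Finset.univ.sup r, (Finset.sup_lt_iff (by simp)).2 fun i _ => hr i, fun i => ?_⟩
  exact (hL i).weaken (Finset.le_sup (Finset.mem_univ i))

lemma dist_skew_iterate_snd_le {D m : ℕ} (S : CIFS D m) {r : ℝ≥0}
    (hr : ∀ i, LipschitzOnWith r (S.φ i) S.V) (n : ℕ) (ω : SymbSp m)
    {x y : EucSp D} (hx : x ∈ S.V) (hy : y ∈ S.V) :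
    dist ((skew S)^[n] (ω, x)).2 ((skew S)^[n] (ω, y)).2 ≤ r ^ n * dist x y := by
  induction n with
  | zero => simp
  | succ n ih =>
    rw [skew_iterate_succ_snd, skew_iterate_succ_snd]
    calc _ ≤ r * dist ((skew S)^[n] (ω, x)).2 ((skew S)^[n] (ω, y)).2 :=
          (hr (ω n)).dist_le_mul _ (skew_iterate_snd_mem S n ω hx) _
            (skew_iterate_snd_mem S n ω hy)
      _ ≤ r * (r ^ n * dist x y) := by gcongr
      _ = r ^ (n + 1) * dist x y := by ring

/-- The fiber coordinates of the iterates of the skew product along a fixed base point forget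
the initial fiber point, uniformly. -/
lemma exists_forall_dist_skew_iterate_snd_lt {D m : ℕ} (S : CIFS D m) {δ : ℝ} (hδ : 0 < δ) :
    ∃ n : ℕ, ∀ ω : SymbSp m, ∀ x ∈ S.V, ∀ y ∈ S.V,
      dist ((skew S)^[n] (ω, x)).2 ((skew S)^[n] (ω, y)).2 < δ := by
  obtain ⟨r, hr1, hr⟩ := S.exists_uniform_contraction
  have ht : Tendsto (fun n : ℕ => (r : ℝ) ^ n * diam S.V) atTop (𝓝 0) := by
    simpa using (tendsto_pow_atTop_nhds_zero_of_lt_one r.coe_nonneg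
      (by exact_mod_cast hr1)).mul_const (diam S.V)
  obtain ⟨n, hn⟩ := (ht.eventually (gt_mem_nhds hδ)).exists
  refine ⟨n, fun ω x hx y hy => (dist_skew_iterate_snd_le S hr n ω hx hy).trans_lt ?_⟩
  refine lt_of_le_of_lt ?_ hn
  gcongr
  exact dist_le_diam_of_mem S.compactV.isBounded hx hy

lemma CIFS.limitSet_subset {D m : ℕ} (S : CIFS D m) : S.limitSet ⊆ S.V := by
  intro x hx
  obtain ⟨ω, hω⟩ := mem_iUnion.1 hx
  simpa [word, compWord] using mem_iInter.1 hω 0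

/-- The prefix `η_1 … η_n` followed by the sequence `ζ`. -/
def concat {m : ℕ} (n : ℕ) (η ζ : SymbSp m) : SymbSp m :=
  fun j => if j < n then η j else ζ (j - n)

lemma shift_iterate_concat {m : ℕ} (n : ℕ) (η ζ : SymbSp m) :
    shift^[n] (concat n η ζ) = ζ := by
  funext j
  simp [shift_iterate_apply, concat]

lemma cyl_word_concat {m : ℕ} (n k : ℕ) (η ζ : SymbSp m) :
    cyl (word (concat n η ζ) (n + k)) = cyl (word η n) ∩ shift^[n] ⁻¹' cyl (word ζ k) := by
  ext ω
  simp only [mem_inter_iff, mem_preimage, mem_cyl_word_iff, shift_iterate_apply, concat]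
  constructor
  · refine fun h => ⟨fun j hj => ?_, fun j hj => ?_⟩
    · simpa [hj] using h j (by omega)
    · simpa using h (n + j) (by omega)
  · rintro ⟨h₁, h₂⟩ j hj
    split_ifs with hjn
    · exact h₁ j hjn
    · have := h₂ (j - n) (by omega)
      rwa [Nat.add_sub_cancel' (by omega)] at this

lemma cyl_word_concat_left {m : ℕ} (n : ℕ) (η ζ : SymbSp m) :
    cyl (word (concat n η ζ) n) = cyl (word η n) := by
  simpa [cyl, word] using cyl_word_concat n 0 η ζ

/-- A Gibbs measure is quasi-Bernoulli on cylinders. -/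
lemma IsGibbs.exists_quasiBernoulli {m : ℕ} {ψ : SymbSp m → ℝ} {P : ℝ}
    {μ : Measure (SymbSp m)} [IsFiniteMeasure μ] (h : IsGibbs ψ P μ) :
    (∀ ζ k, μ (cyl (word ζ k)) ≠ 0) ∧ ∃ C : ℝ≥0, 0 < C ∧ ∀ (n k : ℕ) (η ζ : SymbSp m),
      μ (cyl (word η n) ∩ shift^[n] ⁻¹' cyl (word ζ k)) ≤
        C * (μ (cyl (word η n)) * μ (cyl (word ζ k))) ∧
      μ (cyl (word η n)) * μ (cyl (word ζ k)) ≤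
        C * μ (cyl (word η n) ∩ shift^[n] ⁻¹' cyl (word ζ k)) := by
  obtain ⟨c, hc, h⟩ := h
  have hc0 : 0 < c := by linarith
  refine ⟨fun ζ k h0 => ?_, c.toNNReal ^ 3, ?_, fun n k η ζ => ?_⟩
  · have := (h ζ k).1
    rw [h0, ENNReal.toReal_zero] at this
    exact absurd this (not_le.2 (by positivity))
  · exact pow_pos (Real.toNNReal_pos.2 hc0) 3
  obtain ⟨a₁, a₂⟩ := h (concat n η ζ) n
  obtain ⟨b₁, b₂⟩ := h ζ k
  obtain ⟨d₁, d₂⟩ := h (concat n η ζ) (n + k)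
  rw [cyl_word_concat_left] at a₁ a₂
  rw [cyl_word_concat, birk_add, shift_iterate_concat,
    show birk ψ n (concat n η ζ) + birk ψ k ζ - ((n + k : ℕ) : ℝ) * P =
      (birk ψ n (concat n η ζ) - n * P) + (birk ψ k ζ - k * P) by push_cast; ring,
    Real.exp_add] at d₁ d₂
  set x := Real.exp (birk ψ n (concat n η ζ) - n * P)
  set y := Real.exp (birk ψ k ζ - k * P)
  have hx : 0 < x := Real.exp_pos _
  have hy : 0 < y := Real.exp_pos _
  have key : ∀ s t : ℝ≥0∞, s ≠ ⊤ → t ≠ ⊤ → s.toReal ≤ c ^ 3 * t.toReal →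
      s ≤ ((c.toNNReal ^ 3 : ℝ≥0) : ℝ≥0∞) * t := by
    intro s t hs ht hst
    rw [← ENNReal.toReal_le_toReal hs (ENNReal.mul_ne_top ENNReal.coe_ne_top ht),
      ENNReal.toReal_mul]
    simpa [hc0.le] using hst
  have hab := ENNReal.mul_ne_top (measure_ne_top μ (cyl (word η n)))
    (measure_ne_top μ (cyl (word ζ k)))
  constructor
  · refine key _ _ (measure_ne_top _ _) hab ?_
    rw [ENNReal.toReal_mul]
    calc _ ≤ c * (x * y) := d₂
      _ = c ^ 3 * ((c⁻¹ * x) * (c⁻¹ * y)) := by field_simp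
      _ ≤ _ := by gcongr
  · refine key _ _ hab (measure_ne_top _ _) ?_
    rw [ENNReal.toReal_mul]
    calc _ ≤ (c * x) * (c * y) := by gcongr
      _ = c ^ 3 * (c⁻¹ * (x * y)) := by field_simp
      _ ≤ _ := by gcongr

/-- Inequalities between finite measures on prefix cylinders pass to all sets that depend only on
the first `n` coordinates. -/
lemma measure_le_of_cyl_le {m : ℕ} [NeZero m] {μ ν : Measure (SymbSp m)} (n : ℕ)
    (h : ∀ η, μ (cyl (word η n)) ≤ ν (cyl (word η n))) {G : Set (SymbSp m)}
    (hG : ∀ ω η : SymbSp m, (∀ j < n, ω j = η j) → ω ∈ G → η ∈ G) : μ G ≤ ν G := by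
  classical
  let pref : SymbSp m → (Fin n → Fin m) := fun ω j => ω j
  have hpref : Measurable pref := measurable_pi_lambda _ fun j => measurable_pi_apply (j : ℕ)
  let ext : (Fin n → Fin m) → SymbSp m := fun u j => if hj : j < n then u ⟨j, hj⟩ else 0
  have hfib : ∀ u, pref ⁻¹' {u} = cyl (word (ext u) n) := by
    intro u
    ext ω
    simp only [mem_preimage, mem_singleton_iff, mem_cyl_word_iff, funext_iff, Fin.forall_iff]
    exact forall₂_congr fun j hj => by simp [pref, ext, hj]
  let U : Finset (Fin n → Fin m) := Finset.univ.filter fun u => u ∈ pref '' G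
  have hU : G = pref ⁻¹' (U : Set (Fin n → Fin m)) := by
    ext ω
    simp only [U, mem_preimage, Finset.coe_filter, Finset.mem_univ, true_and, mem_ofPred_eq]
    refine ⟨fun hω => ⟨ω, hω, rfl⟩, ?_⟩
    rintro ⟨η, hη, he⟩
    exact hG η ω (fun j hj => congrFun he ⟨j, hj⟩) hη
  have hm : ∀ u ∈ U, MeasurableSet (pref ⁻¹' {u}) := fun u _ =>
    hpref (measurableSet_singleton u)
  rw [hU, ← sum_measure_preimage_singleton U hm, ← sum_measure_preimage_singleton U hm]
  refine Finset.sum_le_sum fun u _ => ?_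
  rw [hfib]
  exact h _

lemma measure_le_of_isClosed_le {X : Type*} [PseudoEMetricSpace X] [MeasurableSpace X]
    [BorelSpace X] {μ ν : Measure X} [IsFiniteMeasure μ]
    (h : ∀ F, IsClosed F → μ F ≤ ν F) {A : Set X} (hA : MeasurableSet A) : μ A ≤ ν A := by
  rw [hA.measure_eq_iSup_isClosed_of_ne_top (measure_ne_top μ A)]
  exact iSup₂_le fun F hFA => iSup_le fun hF => (h F hF).trans (measure_mono hFA)

lemma measure_isClosed_le_of_thickening_le {X : Type*} [PseudoEMetricSpace X] [MeasurableSpace X]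
    [OpensMeasurableSpace X] {ν : Measure X} [IsFiniteMeasure ν] {F : Set X} (hF : IsClosed F)
    {c : ℝ≥0∞} (h : ∀ δ > 0, c ≤ ν (thickening δ F)) : c ≤ ν F := by
  refine ge_of_tendsto (tendsto_measure_thickening_of_isClosed
    ⟨1, one_pos, measure_ne_top _ _⟩ hF) ?_
  filter_upwards [self_mem_nhdsWithin] with δ hδ using h δ hδ

section Lift

variable {D m : ℕ} {S : CIFS D m} {μplus : Measure (SymbSp m)}
  {μhat : Measure (SymbSp m × EucSp D)}

lemma CIFS.IsLift.ae_snd_mem (h : S.IsLift μplus μhat) : ∀ᵐ p ∂μhat, p.2 ∈ S.V := by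
  have h' : ∀ᵐ p ∂μhat, p.2 ∈ S.limitSet := h.2.2.2
  filter_upwards [h'] with p hp using S.limitSet_subset hp

lemma CIFS.IsLift.measurePreserving_iterate (h : S.IsLift μplus μhat) (n : ℕ) :
    MeasurePreserving (skew S)^[n] μhat μhat :=
  MeasurePreserving.iterate ⟨measurable_skew S, h.2.1⟩ n

lemma measurable_skew_iterate_snd (S : CIFS D m) (n : ℕ) (x : EucSp D) :
    Measurable fun ω : SymbSp m => ((skew S)^[n] (ω, x)).2 :=
  measurable_snd.comp (((measurable_skew S).iterate n).comp
    (measurable_id.prodMk measurable_const))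

/-- At a time `n` with fiber contraction below `δ`, the lift is approximated by the distribution of
the fiber coordinate started at `x`. -/
lemma CIFS.IsLift.approx (h : S.IsLift μplus μhat) {δ : ℝ} {n : ℕ}
    (hn : ∀ ω : SymbSp m, ∀ x ∈ S.V, ∀ y ∈ S.V,
      dist ((skew S)^[n] (ω, x)).2 ((skew S)^[n] (ω, y)).2 < δ)
    {x : EucSp D} (hx : x ∈ S.V) {E : Set (SymbSp m)} (hE : MeasurableSet E)
    {B : Set (EucSp D)} (hB : MeasurableSet B) :
    μhat (E ×ˢ B) ≤
      μplus ((fun ω => ((skew S)^[n] (ω, x)).2) ⁻¹' thickening δ B ∩ shift^[n] ⁻¹' E) ∧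
    μplus ((fun ω => ((skew S)^[n] (ω, x)).2) ⁻¹' B ∩ shift^[n] ⁻¹' E) ≤
      μhat (E ×ˢ thickening δ B) := by
  have hG : ∀ B : Set (EucSp D), MeasurableSet B →
      μplus ((fun ω => ((skew S)^[n] (ω, x)).2) ⁻¹' B ∩ shift^[n] ⁻¹' E) =
      μhat (Prod.fst ⁻¹'
        ((fun ω => ((skew S)^[n] (ω, x)).2) ⁻¹' B ∩ shift^[n] ⁻¹' E)) := by
    intro B hB
    rw [← h.2.2.1, Measure.map_apply measurable_fst]
    exact (measurable_skew_iterate_snd S n x hB).inter ((measurable_shift.iterate n) hE)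
  have hpre := h.measurePreserving_iterate n
  rw [hG _ isOpen_thickening.measurableSet, hG B hB,
    ← hpre.measure_preimage (hE.prod hB).nullMeasurableSet,
    ← hpre.measure_preimage (hE.prod isOpen_thickening.measurableSet).nullMeasurableSet]
  constructor
  · refine measure_mono_ae ?_
    filter_upwards [h.ae_snd_mem] with p hp hmem
    obtain ⟨h₁, h₂⟩ := hmem
    rw [skew_iterate_fst] at h₁
    exact ⟨mem_thickening_iff.2 ⟨_, h₂, hn p.1 x hx p.2 hp⟩, h₁⟩
  · refine measure_mono_ae ?_
    filter_upwards [h.ae_snd_mem] with p hp hmem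
    obtain ⟨h₂, h₁⟩ := hmem
    refine ⟨?_, mem_thickening_iff.2 ⟨_, h₂, hn p.1 p.2 hp x hx⟩⟩
    rw [skew_iterate_fst]
    exact h₁

/-- If, for prefixes `η` of any length, the `μ⁺`-measure of `η` followed by `E` is at most a
multiple of the measure of `η` followed by `E'`, then the same holds for the lifted measures
of `E × A` and `E' × A`. -/
lemma CIFS.IsLift.prod_le (h : S.IsLift μplus μhat) [NeZero m] [IsFiniteMeasure μplus]
    {E E' : Set (SymbSp m)} (hE : MeasurableSet E) (hE' : MeasurableSet E') {a b : ℝ≥0}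
    (hle : ∀ n η, a * μplus (cyl (word η n) ∩ shift^[n] ⁻¹' E) ≤
      b * μplus (cyl (word η n) ∩ shift^[n] ⁻¹' E'))
    {A : Set (EucSp D)} (hA : MeasurableSet A) :
    a * μhat (E ×ˢ A) ≤ b * μhat (E' ×ˢ A) := by
  have : IsProbabilityMeasure μhat := h.1
  obtain ⟨x, hx⟩ := S.interiorV
  replace hx := interior_subset hx
  let ρ : Set (SymbSp m) → Measure (EucSp D) := fun E =>
    (μhat.restrict (Prod.fst ⁻¹' E)).map Prod.snd
  have hρ : ∀ E : Set (SymbSp m), ∀ B, MeasurableSet B →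
      ρ E B = μhat (E ×ˢ B) := by
    intro E B hB
    rw [Measure.map_apply measurable_snd hB, Measure.restrict_apply (measurable_snd hB),
      inter_comm, Set.prod_eq]
  have main : ∀ F, IsClosed F → (a • ρ E) F ≤ (b • ρ E') F := by
    intro F hF
    refine measure_isClosed_le_of_thickening_le hF fun δ hδ => ?_
    obtain ⟨n, hn⟩ := exists_forall_dist_skew_iterate_snd_lt S (half_pos hδ)
    have hsub : thickening (δ / 2) (thickening (δ / 2) F) ⊆ thickening δ F := by
      simpa using thickening_thickening_subset (δ / 2) (δ / 2) F
    have hmid := measure_le_of_cyl_le (μ := a • μplus.restrict (shift^[n] ⁻¹' E))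
      (ν := b • μplus.restrict (shift^[n] ⁻¹' E')) n
      (fun η => by
        simpa [Measure.restrict_apply (measurableSet_cyl_word η n)] using hle n η)
      (G := (fun ω => ((skew S)^[n] (ω, x)).2) ⁻¹' thickening (δ / 2) F)
      (fun ω η hωη hω => by
        rw [mem_preimage] at hω ⊢
        rwa [← skew_iterate_snd_congr S n x hωη])
    have hGm := measurable_skew_iterate_snd S n x
      (isOpen_thickening (δ := δ / 2) (E := F)).measurableSet
    simp only [Measure.smul_apply, Measure.restrict_apply hGm, ENNReal.smul_def,
      smul_eq_mul] at hmid
    simp only [Measure.smul_apply, ENNReal.smul_def, smul_eq_mul]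
    rw [hρ E F hF.measurableSet, hρ E' _ isOpen_thickening.measurableSet]
    calc _ ≤ _ := mul_le_mul_right (h.approx hn hx hE hF.measurableSet).1 _
      _ ≤ _ := hmid
      _ ≤ _ := mul_le_mul_right
        (h.approx hn hx hE' isOpen_thickening.measurableSet).2 _
      _ ≤ _ := mul_le_mul_right (measure_mono (prod_mono_right hsub)) _
  have := measure_le_of_isClosed_le main hA
  simpa only [Measure.smul_apply, ENNReal.smul_def, smul_eq_mul, hρ _ _ hA] using this

/-- The conditional measures on cylinders are uniformly comparable to the projection to the
fiber. -/
lemma CIFS.IsLift.exists_cyl_comparable (h : S.IsLift μplus μhat) [NeZero m]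
    [IsFiniteMeasure μplus] {ψ : SymbSp m → ℝ} {P : ℝ} (hG : IsGibbs ψ P μplus) :
    ∃ C : ℝ≥0, 0 < C ∧ ∀ (ζ : SymbSp m) (k : ℕ) (A : Set (EucSp D)), MeasurableSet A →
      μhat (cyl (word ζ k) ×ˢ A) / μplus (cyl (word ζ k)) ≤ C * μhat.map Prod.snd A ∧
      μhat.map Prod.snd A ≤ C * (μhat (cyl (word ζ k) ×ˢ A) / μplus (cyl (word ζ k))) := by
  obtain ⟨hpos, C, hC, hq⟩ := hG.exists_quasiBernoulli
  refine ⟨C, hC, fun ζ k A hA => ?_⟩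
  have h0 := hpos ζ k
  have htop := measure_ne_top μplus (cyl (word ζ k))
  have hcyl := measurableSet_cyl_word ζ k
  have hcoe : ((μplus (cyl (word ζ k))).toNNReal : ℝ≥0∞) = μplus (cyl (word ζ k)) :=
    ENNReal.coe_toNNReal htop
  rw [Measure.map_apply measurable_snd hA, ← univ_prod]
  constructor
  · have := h.prod_le hcyl MeasurableSet.univ (a := 1)
      (b := C * (μplus (cyl (word ζ k))).toNNReal) (fun n η => by
        simpa [hcoe, mul_assoc, mul_comm, mul_left_comm] using (hq n k η ζ).1) hA
    rw [ENNReal.div_le_iff h0 htop]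
    simpa [hcoe, mul_assoc, mul_comm, mul_left_comm] using this
  · have := h.prod_le MeasurableSet.univ hcyl (a := (μplus (cyl (word ζ k))).toNNReal)
      (b := C) (fun n η => by
        simpa [hcoe, mul_comm] using (hq n k η ζ).2) hA
    rw [← mul_div_assoc, ENNReal.le_div_iff_mul_le (Or.inl h0) (Or.inl htop)]
    simpa [hcoe, mul_comm] using this

end Lift

/-- third part of Lemma 1 of the paper. For `ν₂ = (π₂)_* μ̂`,
there is `C > 0` such that for `μ⁺`-a.e. `ω` and every Borel `A ⊆ Λ`,
`(1/C)·μ_ω(A) ≤ ν₂(A) ≤ C·μ_ω(A)`. -/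
theorem statement9 {D m : ℕ} (hD : 1 ≤ D) (hm : 1 ≤ m) (S : CIFS D m)
    (ψ : SymbSp m → ℝ) (hψ : HolderPotential ψ) (P : ℝ)
    (μplus : Measure (SymbSp m)) (hμplus : IsEquilibrium ψ P μplus)
    (μhat : Measure (SymbSp m × EucSp D)) (hμhat : S.IsLift μplus μhat)
    (κ : SymbSp m → Measure (EucSp D)) (hκ : IsCondSystem μplus μhat κ)
    (ν₂ : Measure (EucSp D)) (hν₂ : ν₂ = μhat.map Prod.snd) :
    ∃ C : ℝ≥0, 0 < C ∧ ∀ᵐ ω ∂μplus,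
      ∀ A : Set (EucSp D), A ⊆ S.limitSet → MeasurableSet A →
        (C : ℝ≥0∞)⁻¹ * κ ω A ≤ ν₂ A ∧ ν₂ A ≤ (C : ℝ≥0∞) * κ ω A := by
  have : NeZero m := ⟨by omega⟩
  have := hμplus.1
  obtain ⟨C, hC, h⟩ := hμhat.exists_cyl_comparable hμplus.2.2
  refine ⟨C, hC, ?_⟩
  filter_upwards [hκ] with ω hω A _ hA
  subst hν₂
  have hC0 : (C : ℝ≥0∞) ≠ 0 := by exact_mod_cast hC.ne'
  constructor
  · rw [mul_comm, ← div_eq_mul_inv, ENNReal.div_le_iff' hC0 ENNReal.coe_ne_top]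
    exact le_of_tendsto' (hω A hA) fun n => (h ω n A hA).1
  · exact ge_of_tendsto' (ENNReal.Tendsto.const_mul (hω A hA) (Or.inr ENNReal.coe_ne_top))
      fun n => (h ω n A hA).2
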